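/- Let q ≥ 1 with Hölder conjugate p (1/p + 1/q = 1, with p = ∞ when q = 1), let R_1,…,R_n ∈ ℝ^d, let φ ∈ ℝ^d with φ ≠ 0, and let δ > 0. Then, with Φ_λ(r) := sup_{u ∈ ℝ^d} ( −⟨φ,u⟩ − λ‖u − r‖_q² ) for λ ≥ 0 (so Φ_0(r) = +∞ since φ ≠ 0), one has inf_{λ ≥ 0} [ λδ + (1/n) Σ_{i=1}^n Φ_λ(R_i) ] = √δ ‖φ‖_p − (1/n) Σ_{i=1}^n ⟨φ,R_i⟩. -/

import Mathlib

open MeasureTheory ENNReal NNReal Filter Topology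

noncomputable section

/-- The `l_p` norm on `ℝ^d`, for an extended exponent `p` (sup-norm when `p = ∞`). -/
def lpNorm {d : ℕ} (p : ℝ≥0∞) (x : Fin d → ℝ) : ℝ :=
  if p = ∞ then ⨆ i, |x i| else (∑ i, |x i| ^ p.toReal) ^ (1 / p.toReal)

/-- `p ∈ [1,∞]` is the Hölder conjugate of `q ∈ [1,∞)`: `1/p + 1/q = 1`,
with `p = ∞` when `q = 1`. -/
def HolderConjugate (q : ℝ) (p : ℝ≥0∞) : Prop :=
  (q = 1 ∧ p = ∞) ∨ (1 < q ∧ p ≠ ∞ ∧ 1 / p.toReal + 1 / q = 1)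

/-- The optimal transport discrepancy between two Borel probability measures on `ℝ^d`
associated with a cost function `c`. -/
def Dc {d : ℕ} (c : (Fin d → ℝ) → (Fin d → ℝ) → ℝ≥0∞)
    (P Q : Measure (Fin d → ℝ)) : ℝ≥0∞ :=
  ⨅ (π : Measure ((Fin d → ℝ) × (Fin d → ℝ))) (_ : IsProbabilityMeasure π)
    (_ : π.map Prod.fst = P) (_ : π.map Prod.snd = Q), ∫⁻ x, c x.1 x.2 ∂π

/-- The quadratic `l_q` transport cost `c(u,w) = ‖u - w‖_q²`. -/
def costQ {d : ℕ} (q : ℝ) (u w : Fin d → ℝ) : ℝ≥0∞ :=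
  ENNReal.ofReal (lpNorm (ENNReal.ofReal q) (u - w) ^ 2)

/-- The empirical measure `P_n = (1/n) ∑_{i=1}^n δ_{R_i}`. -/
def empMeasure {d n : ℕ} (R : Fin n → Fin d → ℝ) : Measure (Fin d → ℝ) :=
  (n : ℝ≥0∞)⁻¹ • ∑ i : Fin n, Measure.dirac (R i)

/-- Weak convergence of a sequence of measures, expressed via integration of
bounded continuous functions. -/
def WeakConv {E : Type*} [TopologicalSpace E] [MeasurableSpace E]
    (μs : ℕ → Measure E) (ν : Measure E) : Prop :=
  ∀ f : BoundedContinuousFunction E ℝ,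
    Tendsto (fun n => ∫ x, f x ∂(μs n)) atTop (𝓝 (∫ x, f x ∂ν))

/-- For a finite exponent `q ≥ 1` the `l_q` norm is given by the power-sum formula. -/
theorem lpNorm_ofReal {d : ℕ} {q : ℝ} (hq : 1 ≤ q) (x : Fin d → ℝ) :
    _root_.lpNorm (ENNReal.ofReal q) x = (∑ i, |x i| ^ q) ^ (1 / q) := by
  unfold _root_.lpNorm
  rw [if_neg ENNReal.ofReal_ne_top, ENNReal.toReal_ofReal (by linarith)]

theorem lpNorm_nonneg {d : ℕ} (p : ℝ≥0∞) (x : Fin d → ℝ) : 0 ≤ _root_.lpNorm p x := by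
  unfold _root_.lpNorm
  split_ifs
  · exact Real.iSup_nonneg fun i => abs_nonneg _
  · positivity

theorem lpNorm_ofReal_neg {d : ℕ} {q : ℝ} (hq : 1 ≤ q) (x : Fin d → ℝ) :
    _root_.lpNorm (ENNReal.ofReal q) (-x) = _root_.lpNorm (ENNReal.ofReal q) x := by
  simp [lpNorm_ofReal hq]

theorem lpNorm_ofReal_smul {d : ℕ} {q : ℝ} (hq : 1 ≤ q) {t : ℝ} (ht : 0 ≤ t) (x : Fin d → ℝ) :
    _root_.lpNorm (ENNReal.ofReal q) (t • x) = t * _root_.lpNorm (ENNReal.ofReal q) x := by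
  have hq0 : q ≠ 0 := by linarith
  simp only [lpNorm_ofReal hq, Pi.smul_apply, smul_eq_mul, abs_mul, abs_of_nonneg ht]
  simp_rw [Real.mul_rpow ht (abs_nonneg _)]
  rw [← Finset.mul_sum, Real.mul_rpow (by positivity) (by positivity), ← Real.rpow_mul ht,
    mul_one_div_cancel hq0, Real.rpow_one]

theorem HolderConjugate.real {q : ℝ} {p : ℝ≥0∞} (hq : 1 < q)
    (h : 1 / p.toReal + 1 / q = 1) : p.toReal.HolderConjugate q :=
  (Real.holderConjugate_iff.2 ⟨hq, by simpa [add_comm] using h⟩).symm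

/-- Hölder's inequality for the pairing of `l_p` and `l_q`. -/
theorem HolderConjugate.sum_mul_le {d : ℕ} {q : ℝ} {p : ℝ≥0∞} (hq : 1 ≤ q)
    (hpq : _root_.HolderConjugate q p) (x y : Fin d → ℝ) :
    ∑ j, x j * y j ≤ _root_.lpNorm p x * _root_.lpNorm (ENNReal.ofReal q) y := by
  rw [lpNorm_ofReal hq]
  unfold _root_.lpNorm
  rcases hpq with ⟨rfl, rfl⟩ | ⟨hq1, hp, h⟩
  · simp only [if_true, Real.rpow_one, div_one, Finset.mul_sum]
    refine Finset.sum_le_sum fun j _ => (le_abs_self _).trans ?_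
    rw [abs_mul]
    gcongr
    exact le_ciSup (f := fun i => |x i|) (Set.finite_range _).bddAbove j
  · rw [if_neg hp]
    exact Real.inner_le_Lp_mul_Lq _ _ _ (HolderConjugate.real hq1 h)

/-- The supremum defining the dual norm is attained on the unit ball. -/
theorem HolderConjugate.exists_sum_mul_eq {d : ℕ} {q : ℝ} {p : ℝ≥0∞} (hq : 1 ≤ q)
    (hpq : _root_.HolderConjugate q p) (x : Fin d → ℝ) :
    ∃ y : Fin d → ℝ, _root_.lpNorm (ENNReal.ofReal q) y ≤ 1 ∧
      ∑ j, x j * y j = _root_.lpNorm p x := by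
  simp only [lpNorm_ofReal hq]
  unfold _root_.lpNorm
  rcases hpq with ⟨rfl, rfl⟩ | ⟨hq1, hp, h⟩
  · simp only [if_true, Real.rpow_one, div_one]
    rcases isEmpty_or_nonempty (Fin d) with hd | hd
    · exact ⟨0, by simp⟩
    · obtain ⟨i, hi⟩ := exists_eq_ciSup_of_finite (f := fun i => |x i|)
      refine ⟨Pi.single i (SignType.sign (x i) : ℝ), ?_, ?_⟩
      · rw [Finset.sum_eq_single i (fun j _ hj => by simp [hj]) (by simp)]
        rcases lt_trichotomy (x i) 0 with h | h | h <;> simp [h]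
      · rw [← hi, Finset.sum_eq_single i (fun j _ hj => by simp [hj]) (by simp)]
        simp
  · rw [if_neg hp]
    obtain ⟨g, hg, hgx⟩ := (NNReal.isGreatest_Lp Finset.univ (fun i => ‖x i‖₊)
      (HolderConjugate.real hq1 h)).1
    have hg : ∑ i, g i ^ q ≤ 1 := hg
    refine ⟨fun i => SignType.sign (x i) * g i, ?_, ?_⟩
    · refine Real.rpow_le_one (by positivity) (le_trans ?_ (NNReal.coe_le_coe.2 hg)) (by positivity)
      push_cast
      refine Finset.sum_le_sum fun i _ => ?_
      refine Real.rpow_le_rpow (abs_nonneg _) ?_ (by linarith)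
      rcases lt_trichotomy (x i) 0 with h | h | h <;> simp [h]
    · have := congrArg NNReal.toReal hgx
      push_cast at this
      simpa [← mul_assoc] using this

/-- The coercion from `ℝ` to `EReal` commutes with finite sums. -/
theorem EReal.coe_finset_sum {ι : Type*} (s : Finset ι) (f : ι → ℝ) :
    ((∑ i ∈ s, f i : ℝ) : EReal) = ∑ i ∈ s, (f i : EReal) := by
  classical
  induction s using Finset.induction_on with
  | empty => simp
  | insert a s ha ih => rw [Finset.sum_insert ha, Finset.sum_insert ha, EReal.coe_add, ih]

/-- The dual of the worst-case mean problem, with the inner suprema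
taken in the extended reals:
`inf_{λ ≥ 0} [λδ + (1/n) ∑ᵢ Φ_λ(Rᵢ)] = √δ‖φ‖_p − (1/n) ∑ᵢ ⟨φ,Rᵢ⟩`. -/
theorem stmt2 {d n : ℕ} (hn : 0 < n) (q : ℝ) (hq : 1 ≤ q) (p : ℝ≥0∞)
    (hpq : HolderConjugate q p) (R : Fin n → Fin d → ℝ) (φ : Fin d → ℝ) (hφ : φ ≠ 0)
    (δ : ℝ) (hδ : 0 < δ) :
    (⨅ (lam : ℝ) (_ : 0 ≤ lam),
        ((lam * δ : ℝ) : EReal) + ((1 / n : ℝ) : EReal) *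
          ∑ i : Fin n, ⨆ u : Fin d → ℝ,
            ((-(∑ j, φ j * u j) - lam * lpNorm (ENNReal.ofReal q) (u - R i) ^ 2 : ℝ) : EReal)) =
      ((Real.sqrt δ * lpNorm p φ - (1 / n : ℝ) * ∑ i, ∑ j, φ j * R i j : ℝ) : EReal) := by
  have hn' : (n : ℝ) ≠ 0 := by positivity
  have hinv : (0 : EReal) ≤ ((1 / n : ℝ) : EReal) := EReal.coe_nonneg.2 (by positivity)
  have hs : 0 < √δ := Real.sqrt_pos.2 hδ
  have hss : √δ ^ 2 = δ := Real.sq_sqrt hδ.le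
  set N := _root_.lpNorm p φ with hN
  have hN0 : 0 ≤ N := lpNorm_nonneg p φ
  apply le_antisymm
  · refine iInf₂_le_of_le (N / (2 * √δ)) (by positivity) ?_
    have hsup : ∀ i, (⨆ u : Fin d → ℝ, ((-(∑ j, φ j * u j) - N / (2 * √δ) *
        _root_.lpNorm (ENNReal.ofReal q) (u - R i) ^ 2 : ℝ) : EReal)) ≤
        ((-(∑ j, φ j * R i j) + √δ * N / 2 : ℝ) : EReal) := by
      intro i
      refine iSup_le fun u => EReal.coe_le_coe_iff.2 ?_
      have hH := HolderConjugate.sum_mul_le hq hpq φ (-(u - R i))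
      rw [lpNorm_ofReal_neg hq, ← hN] at hH
      set s := _root_.lpNorm (ENNReal.ofReal q) (u - R i)
      have hexp : ∑ j, φ j * (-(u - R i)) j = ∑ j, φ j * R i j - ∑ j, φ j * u j := by
        rw [← Finset.sum_sub_distrib]
        exact Finset.sum_congr rfl fun j _ => by simp; ring
      have hsq : √δ * N / 2 + N / (2 * √δ) * s ^ 2 - N * s = N / (2 * √δ) * (s - √δ) ^ 2 := by
        field_simp
        ring
      have : 0 ≤ N / (2 * √δ) * (s - √δ) ^ 2 := by positivity
      linarith
    refine (add_le_add_right (mul_le_mul_of_nonneg_left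
      (Finset.sum_le_sum fun i _ => hsup i) hinv) _).trans ?_
    rw [← EReal.coe_finset_sum, ← EReal.coe_mul, ← EReal.coe_add, EReal.coe_le_coe_iff]
    rw [Finset.sum_add_distrib, Finset.sum_neg_distrib, Finset.sum_const, Finset.card_univ,
      Fintype.card_fin, nsmul_eq_mul]
    have h₁ : N / (2 * √δ) * δ = √δ * N / 2 := by
      nth_rewrite 2 [← hss]
      field_simp
    have h₂ : (1 / n : ℝ) * (n * (√δ * N / 2)) = √δ * N / 2 := by field_simp
    rw [mul_add, h₁, h₂]
    linarith
  · refine le_iInf₂ fun lam hlam => ?_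
    obtain ⟨v, hv, hφv⟩ := HolderConjugate.exists_sum_mul_eq hq hpq φ
    have hsup : ∀ i, ((-(∑ j, φ j * R i j) + √δ * N - lam * δ : ℝ) : EReal) ≤
        ⨆ u : Fin d → ℝ, ((-(∑ j, φ j * u j) - lam *
          _root_.lpNorm (ENNReal.ofReal q) (u - R i) ^ 2 : ℝ) : EReal) := by
      intro i
      refine le_iSup_of_le (R i - √δ • v) (EReal.coe_le_coe_iff.2 ?_)
      have hexp : ∑ j, φ j * (R i - √δ • v) j = ∑ j, φ j * R i j - √δ * N := by
        rw [hN, ← hφv, Finset.mul_sum, ← Finset.sum_sub_distrib]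
        exact Finset.sum_congr rfl fun j _ => by simp; ring
      rw [hexp, sub_sub_cancel_left, lpNorm_ofReal_neg hq, lpNorm_ofReal_smul hq hs.le, mul_pow,
        hss]
      have : lam * (δ * _root_.lpNorm (ENNReal.ofReal q) v ^ 2) ≤ lam * (δ * 1) := by
        gcongr
        exact pow_le_one₀ (lpNorm_nonneg _ _) hv
      linarith
    refine le_trans ?_ (add_le_add_right (mul_le_mul_of_nonneg_left
      (Finset.sum_le_sum fun i _ => hsup i) hinv) _)
    rw [← EReal.coe_finset_sum, ← EReal.coe_mul, ← EReal.coe_add, EReal.coe_le_coe_iff]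
    rw [Finset.sum_sub_distrib, Finset.sum_add_distrib, Finset.sum_neg_distrib, Finset.sum_const,
      Finset.sum_const, Finset.card_univ, Fintype.card_fin, nsmul_eq_mul, nsmul_eq_mul]
    have h₁ : (1 / n : ℝ) * (n * (√δ * N)) = √δ * N := by field_simp
    have h₂ : (1 / n : ℝ) * (n * (lam * δ)) = lam * δ := by field_simp
    rw [mul_sub, mul_add, h₁, h₂]
    linarith
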